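/- In the abstract Hilbert optimal-control setting, the error in the adjoint state satisfies ‖p̄ − p_T‖_V² ≤ (4/κ² + 32/(ϑ²κ⁶)) η_st² + (2 + 16/(ϑ²κ⁴)) η_ad² + (8/κ³ + 32/(ϑ²κ⁷)) η_ct². -/

import Mathlib

open MeasureTheory
open scoped InnerProductSpace

/-- The pointwise truncation to `[a, b]` satisfies the variational inequality characterising the
`L²` projection onto the functions with values in `[a, b]`. -/
theorem inner_clamp_sub_nonneg {Ω : Type*} [MeasurableSpace Ω] {μ : Measure Ω} {a b : ℝ}
    (hab : a ≤ b) {w p u : Lp ℝ 2 μ} (hp : ⇑p =ᵐ[μ] fun x => min b (max a (w x)))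
    (hu : ∀ᵐ x ∂μ, a ≤ u x ∧ u x ≤ b) : 0 ≤ ⟪p - w, u - p⟫_ℝ := by
  rw [L2.inner_def]
  refine integral_nonneg_of_ae ?_
  filter_upwards [hp, hu, Lp.coeFn_sub p w, Lp.coeFn_sub u p] with x hpx hux hpw hup
  simp only [hpw, hup, Pi.sub_apply, Pi.zero_apply, RCLike.inner_apply, conj_trivial, hpx]
  obtain ⟨hau, hub⟩ := hux
  rcases le_total (w x) a with hwa | hwa
  · rw [max_eq_left hwa, min_eq_right hab]
    exact mul_nonneg (by linarith) (by linarith)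
  · rw [max_eq_right hwa]
    rcases le_total (w x) b with hwb | hwb
    · simp [min_eq_right hwb]
    · rw [min_eq_left hwb]
      exact mul_nonneg_of_nonpos_of_nonpos (by linarith) (by linarith)

/-- Stability of the solution of a coercive variational problem. -/
theorem norm_sq_le_of_coercive {V H : Type*} [NormedAddCommGroup V] [InnerProductSpace ℝ V]
    [NormedAddCommGroup H] [InnerProductSpace ℝ H] {ι : V →ₗ[ℝ] H} {k : ℝ} (hk : 0 ≤ k)
    (hι : ∀ v, ‖ι v‖ ^ 2 ≤ k * ‖v‖ ^ 2) {v : V} {g : H} (h : ‖v‖ ^ 2 = ⟪g, ι v⟫_ℝ) :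
    ‖v‖ ^ 2 ≤ k * ‖g‖ ^ 2 := by
  rcases (sq_nonneg ‖v‖).eq_or_lt with h0 | h0
  · rw [← h0]
    positivity
  · have hle : ‖v‖ ^ 2 ≤ ‖g‖ * ‖ι v‖ := h.trans_le (real_inner_le_norm g (ι v))
    refine le_of_mul_le_mul_right ?_ h0
    calc ‖v‖ ^ 2 * ‖v‖ ^ 2 ≤ (‖g‖ * ‖ι v‖) * (‖g‖ * ‖ι v‖) :=
          mul_self_le_mul_self h0.le hle
      _ = ‖g‖ ^ 2 * ‖ι v‖ ^ 2 := by ring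
      _ ≤ ‖g‖ ^ 2 * (k * ‖v‖ ^ 2) := by gcongr; exact hι v
      _ = k * ‖g‖ ^ 2 * ‖v‖ ^ 2 := by ring

theorem norm_sub_sq_le_two_mul_add {E : Type*} [SeminormedAddCommGroup E] (x y z : E) :
    ‖x - z‖ ^ 2 ≤ 2 * (‖x - y‖ ^ 2 + ‖y - z‖ ^ 2) :=
  (pow_le_pow_left₀ (norm_nonneg _) (norm_sub_le_norm_sub_add_norm_sub x y z) 2).trans add_sq_le

/-- In the abstract Hilbert optimal-control setting, the error in the adjoint
state satisfies
`‖p̄ − p_T‖² ≤ (4/κ² + 32/(ϑ²κ⁶)) η_st² + (2 + 16/(ϑ²κ⁴)) η_ad² + (8/κ³ + 32/(ϑ²κ⁷)) η_ct²`. -/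
theorem adjoint_error_bound
    {Ω : Type*} [MeasurableSpace Ω] (μ : Measure Ω) [IsFiniteMeasure μ]
    (a b : ℝ) (hab : a < b)
    (Pi : Lp ℝ 2 μ → Lp ℝ 2 μ)
    (hPi : ∀ w : Lp ℝ 2 μ, (⇑(Pi w)) =ᵐ[μ] fun x => min b (max a (w x)))
    (κ ϑ : ℝ) (hκ : 0 < κ) (hϑ : 0 < ϑ)
    {V : Type*} [NormedAddCommGroup V] [InnerProductSpace ℝ V]
    (ι : V →ₗ[ℝ] Lp ℝ 2 μ)
    (hι : ∀ v : V, ‖ι v‖ ≤ (Real.sqrt κ)⁻¹ * ‖v‖)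
    (B Bstar : V →ₗ[ℝ] V →ₗ[ℝ] ℝ)
    (hBstar : ∀ w v : V, Bstar w v = B v w)
    (hBcoer : ∀ v : V, B v v = ‖v‖ ^ 2)
    (f yΩ : Lp ℝ 2 μ)
    (ybar pbar : V) (ubar : Lp ℝ 2 μ)
    (hubar_mem : ∀ᵐ x ∂μ, a ≤ ubar x ∧ ubar x ≤ b)
    (hstate : ∀ v : V, B ybar v = ⟪f + ubar, ι v⟫_ℝ)
    (hadjoint : ∀ w : V, Bstar pbar w = ⟪ι ybar - yΩ, ι w⟫_ℝ)
    (hVI : ∀ u : Lp ℝ 2 μ, (∀ᵐ x ∂μ, a ≤ u x ∧ u x ≤ b) →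
        0 ≤ ⟪ι pbar + ϑ • ubar, u - ubar⟫_ℝ)
    (yT pT : V) (uT : Lp ℝ 2 μ)
    (huT_mem : ∀ᵐ x ∂μ, a ≤ uT x ∧ uT x ≤ b)
    (utilde : Lp ℝ 2 μ) (hutilde : utilde = Pi (-ϑ⁻¹ • ι pT))
    (ηct : ℝ) (hηct : ηct = ‖uT - utilde‖)
    (yhat phat ytilde ptilde : V)
    (hyhat : ∀ v : V, B yhat v = ⟪f + uT, ι v⟫_ℝ)
    (hphat : ∀ w : V, Bstar phat w = ⟪ι yT - yΩ, ι w⟫_ℝ)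
    (hytilde : ∀ v : V, B ytilde v = ⟪f + utilde, ι v⟫_ℝ)
    (hptilde : ∀ w : V, Bstar ptilde w = ⟪ι ytilde - yΩ, ι w⟫_ℝ)
    (ηst ηad : ℝ) (hηst0 : 0 ≤ ηst) (hηad0 : 0 ≤ ηad)
    (hηst : ‖yhat - yT‖ ≤ ηst) (hηad : ‖phat - pT‖ ≤ ηad) :
    ‖pbar - pT‖ ^ 2 ≤ (4 / κ ^ 2 + 32 / (ϑ ^ 2 * κ ^ 6)) * ηst ^ 2
      + (2 + 16 / (ϑ ^ 2 * κ ^ 4)) * ηad ^ 2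
      + (8 / κ ^ 3 + 32 / (ϑ ^ 2 * κ ^ 7)) * ηct ^ 2 := by
  have hk : 0 ≤ κ⁻¹ := inv_nonneg.2 hκ.le
  have hι_sq : ∀ v, ‖ι v‖ ^ 2 ≤ κ⁻¹ * ‖v‖ ^ 2 := fun v => by
    have h := pow_le_pow_left₀ (norm_nonneg _) (hι v) 2
    rwa [mul_pow, inv_pow, Real.sq_sqrt hκ.le] at h
  have state_stab : ∀ {y₁ y₂ : V} {u₁ u₂ : Lp ℝ 2 μ}, (∀ v, B y₁ v = ⟪f + u₁, ι v⟫_ℝ) →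
      (∀ v, B y₂ v = ⟪f + u₂, ι v⟫_ℝ) → ‖y₁ - y₂‖ ^ 2 ≤ κ⁻¹ * ‖u₁ - u₂‖ ^ 2 := by
    intro y₁ y₂ u₁ u₂ h₁ h₂
    refine norm_sq_le_of_coercive hk hι_sq ?_
    rw [← hBcoer, map_sub B, LinearMap.sub_apply, h₁, h₂, ← inner_sub_left, add_sub_add_left_eq_sub]
  have adjoint_stab : ∀ {p₁ p₂ y₁ y₂ : V}, (∀ w, Bstar p₁ w = ⟪ι y₁ - yΩ, ι w⟫_ℝ) →
      (∀ w, Bstar p₂ w = ⟪ι y₂ - yΩ, ι w⟫_ℝ) →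
      ‖p₁ - p₂‖ ^ 2 ≤ κ⁻¹ * (κ⁻¹ * ‖y₁ - y₂‖ ^ 2) := by
    intro p₁ p₂ y₁ y₂ h₁ h₂
    refine (norm_sq_le_of_coercive (g := ι (y₁ - y₂)) hk hι_sq ?_).trans
      (mul_le_mul_of_nonneg_left (hι_sq _) hk)
    rw [← hBcoer, ← hBstar, map_sub Bstar, LinearMap.sub_apply, h₁, h₂, ← inner_sub_left,
      sub_sub_sub_cancel_right, map_sub ι y₁]
  have hut : ⇑utilde =ᵐ[μ] fun x => min b (max a ((-ϑ⁻¹ • ι pT : Lp ℝ 2 μ) x)) :=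
    hutilde ▸ hPi _
  have hut_mem : ∀ᵐ x ∂μ, a ≤ utilde x ∧ utilde x ≤ b := by
    filter_upwards [hut] with x hx
    rw [hx]
    exact ⟨le_min hab.le (le_max_left _ _), min_le_left _ _⟩
  have hVI_tilde : 0 ≤ ⟪ι pT + ϑ • utilde, ubar - utilde⟫_ℝ := by
    have h := mul_nonneg hϑ.le (inner_clamp_sub_nonneg hab.le hut hubar_mem)
    rwa [← real_inner_smul_left, smul_sub, smul_smul, mul_neg, mul_inv_cancel₀ hϑ.ne', neg_one_smul,
      sub_neg_eq_add, add_comm] at h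
  have hmono : ⟪ι pbar - ι ptilde, utilde - ubar⟫_ℝ ≤ 0 := by
    have h : ⟪utilde - ubar, ι (pbar - ptilde)⟫_ℝ = ⟪ι (ybar - ytilde), ι (ytilde - ybar)⟫_ℝ := by
      have h₁ : B (ytilde - ybar) (pbar - ptilde) = ⟪utilde - ubar, ι (pbar - ptilde)⟫_ℝ := by
        rw [map_sub B, LinearMap.sub_apply, hytilde, hstate, ← inner_sub_left,
          add_sub_add_left_eq_sub]
      rw [← h₁, ← hBstar, map_sub Bstar, LinearMap.sub_apply, hadjoint, hptilde, ← inner_sub_left,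
        sub_sub_sub_cancel_right, map_sub ι ybar]
    rw [← map_sub, real_inner_comm, h, ← neg_sub ybar ytilde, map_neg, inner_neg_right, neg_nonpos]
    exact real_inner_self_nonneg
  have hcontrol : ϑ * ‖ubar - utilde‖ ^ 2 ≤ ‖ι (ptilde - pT)‖ * ‖ubar - utilde‖ := by
    have hsplit : ⟪ι pbar + ϑ • ubar, utilde - ubar⟫_ℝ + ⟪ι pT + ϑ • utilde, ubar - utilde⟫_ℝ
        = ⟪ι pbar - ι ptilde, utilde - ubar⟫_ℝ + ⟪ι (ptilde - pT), utilde - ubar⟫_ℝ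
          - ϑ * ‖ubar - utilde‖ ^ 2 := by
      rw [← real_inner_self_eq_norm_sq]
      simp only [map_sub, inner_add_left, inner_sub_left, inner_sub_right, real_inner_smul_left]
      ring
    have hcs := real_inner_le_norm (ι (ptilde - pT)) (utilde - ubar)
    rw [norm_sub_rev utilde ubar] at hcs
    linarith [hVI utilde hut_mem]
  have hcontrol_sq : ‖ubar - utilde‖ ^ 2 ≤ ϑ⁻¹ ^ 2 * (κ⁻¹ * ‖ptilde - pT‖ ^ 2) := by
    have hle : ‖ubar - utilde‖ ≤ ϑ⁻¹ * ‖ι (ptilde - pT)‖ := by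
      rw [← div_eq_inv_mul, le_div_iff₀' hϑ]
      rcases (norm_nonneg (ubar - utilde)).eq_or_lt with h0 | h0
      · rw [← h0, mul_zero]
        exact norm_nonneg _
      · exact le_of_mul_le_mul_right (by linarith) h0
    refine (pow_le_pow_left₀ (norm_nonneg _) hle 2).trans ?_
    rw [mul_pow]
    exact mul_le_mul_of_nonneg_left (hι_sq _) (sq_nonneg _)
  have hst := pow_le_pow_left₀ (norm_nonneg _) hηst 2
  have had := pow_le_pow_left₀ (norm_nonneg _) hηad 2
  have hptilde_sq : ‖ptilde - pT‖ ^ 2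
      ≤ 2 * (κ⁻¹ * (κ⁻¹ * (2 * (κ⁻¹ * ηct ^ 2 + ηst ^ 2))) + ηad ^ 2) := by
    refine (norm_sub_sq_le_two_mul_add _ phat _).trans ?_
    gcongr
    refine (adjoint_stab hptilde hphat).trans ?_
    gcongr
    refine (norm_sub_sq_le_two_mul_add _ yhat _).trans ?_
    gcongr
    rw [hηct, norm_sub_rev uT utilde]
    exact state_stab hytilde hyhat
  calc ‖pbar - pT‖ ^ 2 ≤ 2 * (‖pbar - phat‖ ^ 2 + ‖phat - pT‖ ^ 2) :=
        norm_sub_sq_le_two_mul_add _ _ _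
    _ ≤ 2 * (κ⁻¹ * (κ⁻¹ * ‖ybar - yT‖ ^ 2) + ηad ^ 2) := by
        gcongr
        exact adjoint_stab hadjoint hphat
    _ ≤ 2 * (κ⁻¹ * (κ⁻¹ * (2 * (‖ybar - yhat‖ ^ 2 + ‖yhat - yT‖ ^ 2))) + ηad ^ 2) := by
        gcongr
        exact norm_sub_sq_le_two_mul_add _ _ _
    _ ≤ 2 * (κ⁻¹ * (κ⁻¹ * (2 * (κ⁻¹ * ‖ubar - uT‖ ^ 2 + ηst ^ 2))) + ηad ^ 2) := by
        gcongr
        exact state_stab hstate hyhat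
    _ ≤ 2 * (κ⁻¹ * (κ⁻¹ * (2 * (κ⁻¹ * (2 * (‖ubar - utilde‖ ^ 2 + ηct ^ 2)) + ηst ^ 2)))
          + ηad ^ 2) := by
        gcongr
        rw [hηct, norm_sub_rev uT utilde]
        exact norm_sub_sq_le_two_mul_add _ _ _
    _ ≤ 2 * (κ⁻¹ * (κ⁻¹ * (2 * (κ⁻¹ * (2 * (ϑ⁻¹ ^ 2 * (κ⁻¹ *
          (2 * (κ⁻¹ * (κ⁻¹ * (2 * (κ⁻¹ * ηct ^ 2 + ηst ^ 2))) + ηad ^ 2))) + ηct ^ 2))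
          + ηst ^ 2))) + ηad ^ 2) := by
        gcongr
        refine hcontrol_sq.trans ?_
        gcongr
    _ = _ := by
        field_simp
        ring
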